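/- Let S be a numerical semigroup with m(S) ≤ 8. Then S satisfies Wilf's conjecture, i.e. f(S) + 1 ≤ n(S)·ν(S). -/

import Mathlib

/-- A numerical semigroup: an additive submonoid of `ℕ` (containing `0`, closed under
addition) whose complement in `ℕ` is finite. -/
structure NumericalSemigroup where
  carrier : Set ℕ
  zero_mem : 0 ∈ carrier
  add_mem : ∀ ⦃a b : ℕ⦄, a ∈ carrier → b ∈ carrier → a + b ∈ carrier
  cofinite : (carrierᶜ : Set ℕ).Finite

namespace NumericalSemigroup

/-- The multiplicity `m(S)`: the smallest positive element of `S`. -/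
noncomputable def mult (S : NumericalSemigroup) : ℕ :=
  sInf {s : ℕ | s ∈ S.carrier ∧ 0 < s}

/-- The embedding dimension `ν(S)`: the cardinality of the (unique) minimal system of
generators of `S`, i.e. the least cardinality of a generating set. -/
noncomputable def embdim (S : NumericalSemigroup) : ℕ :=
  sInf {n : ℕ | ∃ G : Finset ℕ,
    S.carrier = (AddSubmonoid.closure (G : Set ℕ) : Set ℕ) ∧ G.card = n}

/-- The Frobenius number `f(S)`: the largest integer not belonging to `S`. -/
noncomputable def frob (S : NumericalSemigroup) : ℤ :=
  sSup {x : ℤ | ∀ s ∈ S.carrier, (s : ℤ) ≠ x}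

/-- `n(S)`: the number of elements of `S` smaller than the Frobenius number. -/
noncomputable def small (S : NumericalSemigroup) : ℕ :=
  {s : ℕ | s ∈ S.carrier ∧ (s : ℤ) < S.frob}.ncard

/-- The type `t(S)`: the number of pseudo-Frobenius numbers of `S`, i.e. integers
`x ∉ S` such that `x + s ∈ S` for every nonzero `s ∈ S`. -/
noncomputable def typ (S : NumericalSemigroup) : ℕ :=
  {x : ℤ | (∀ s ∈ S.carrier, (s : ℤ) ≠ x) ∧
    ∀ s ∈ S.carrier, 0 < s → ∃ u ∈ S.carrier, (u : ℤ) = x + s}.ncard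

/-- The `k`-th interval `I_k = [k·m, (k+1)·m - 1]` (for a given `m`). -/
def interval (m k : ℕ) : Set ℕ := Set.Ico (k * m) ((k + 1) * m)

/-- `n_k`: the number of elements of `S ∩ I_k` smaller than the Frobenius number. -/
noncomputable def nk (S : NumericalSemigroup) (k : ℕ) : ℕ :=
  {s : ℕ | s ∈ S.carrier ∩ interval S.mult k ∧ (s : ℤ) < S.frob}.ncard

/-- `L = ⌊f(S)/m(S)⌋`. -/
noncomputable def Lindex (S : NumericalSemigroup) : ℤ := S.frob / (S.mult : ℤ)

/-- `ρ = f(S) + 1 - L·m(S)`. -/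
noncomputable def rho (S : NumericalSemigroup) : ℤ :=
  S.frob + 1 - S.Lindex * (S.mult : ℤ)

/-- The Apéry set `Ap(S) = {w ∈ S : w - m(S) ∉ S}`. -/
def apery (S : NumericalSemigroup) : Set ℕ :=
  {w : ℕ | w ∈ S.carrier ∧ ∀ u ∈ S.carrier, u + S.mult ≠ w}

theorem apery_finite (S : NumericalSemigroup) : S.apery.Finite := by
  apply Set.Finite.subset ((Set.finite_Iio S.mult).union (S.cofinite.image (· + S.mult)))
  intro x hx
  by_cases h : x < S.mult
  · exact Or.inl h
  · refine Or.inr ⟨x - S.mult, fun hmem => hx.2 _ hmem (by omega), ?_⟩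
    show x - S.mult + S.mult = x
    omega

/-- `w j`: the `(j+1)`-st smallest element of the Apéry set, so that
`Ap(S) = {w 0 < w 1 < ... < w (m-1)}` with `w 0 = 0`. -/
noncomputable def w (S : NumericalSemigroup) (j : ℕ) : ℕ :=
  (S.apery_finite.toFinset.sort (· ≤ ·)).getD j 0

/-- `ε_j`: the number of `k ∈ {0, ..., L-1}` such that `|I_k ∩ S| = j`. -/
noncomputable def eps (S : NumericalSemigroup) (j : ℕ) : ℕ :=
  {k : ℕ | (k : ℤ) < S.Lindex ∧ (S.carrier ∩ interval S.mult k).ncard = j}.ncard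

/-- `η_j`: the number of `k ∈ ℕ` such that `|I_k ∩ S| = j`. -/
noncomputable def eta (S : NumericalSemigroup) (j : ℕ) : ℕ :=
  {k : ℕ | (S.carrier ∩ interval S.mult k).ncard = j}.ncard

/-- Basic facts about the multiplicity. -/
theorem mult_spec (S : NumericalSemigroup) : S.mult ∈ S.carrier ∧ 0 < S.mult := by
  have hne : {s : ℕ | s ∈ S.carrier ∧ 0 < s}.Nonempty := by
    have hinf : (S.carrier).Infinite := by
      intro hf
      have := hf.union S.cofinite
      rw [Set.union_compl_self] at this
      exact Set.infinite_univ this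
    obtain ⟨x, hx, hx0⟩ := hinf.exists_gt 0
    exact ⟨x, hx, hx0⟩
  exact Nat.sInf_mem hne

theorem mult_le (S : NumericalSemigroup) {s : ℕ} (hs : s ∈ S.carrier) (h0 : s ≠ 0) :
    S.mult ≤ s :=
  Nat.sInf_le ⟨hs, Nat.pos_of_ne_zero h0⟩

theorem add_mul_mem (S : NumericalSemigroup) {a : ℕ} (ha : a ∈ S.carrier) {b : ℕ}
    (hb : b ∈ S.carrier) (k : ℕ) : a + k * b ∈ S.carrier := by
  induction k with
  | zero => simpa using ha
  | succ k ih =>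
    have := S.add_mem ih hb
    have e : a + (k + 1) * b = a + k * b + b := by ring
    rwa [e]

theorem apery_inj (S : NumericalSemigroup) {a b : ℕ} (ha : a ∈ S.apery) (hb : b ∈ S.apery)
    (h : a ≡ b [MOD S.mult]) : a = b := by
  have key : ∀ a b : ℕ, a ∈ S.apery → b ∈ S.apery → a ≡ b [MOD S.mult] → ¬ a < b := by
    intro a b ha hb h hlt
    obtain ⟨k, hk⟩ := (Nat.modEq_iff_dvd' hlt.le).1 h
    obtain _ | k := k
    · simp at hk; omega
    · apply hb.2 (a + k * S.mult) (S.add_mul_mem ha.1 S.mult_spec.1 k)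
      have : S.mult * (k + 1) = k * S.mult + S.mult := by ring
      omega
  have h1 := key a b ha hb h
  have h2 := key b a hb ha h.symm
  omega

theorem apery_cover (S : NumericalSemigroup) (x : ℕ) :
    ∃ a ∈ S.apery, a ≡ x [MOD S.mult] := by
  classical
  have hex : ∃ y, y ∈ S.carrier ∧ y ≡ x [MOD S.mult] := by
    by_contra hcon
    push Not at hcon
    have : (Set.range fun k : ℕ => x + k * S.mult) ⊆ S.carrierᶜ := by
      rintro _ ⟨k, rfl⟩ hk
      apply hcon _ hk
      simp [Nat.ModEq]
    refine (Set.infinite_range_of_injective ?_) (S.cofinite.subset this)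
    intro a b hab
    have := S.mult_spec.2
    simpa [this.ne'] using hab
  refine ⟨Nat.find hex, ⟨(Nat.find_spec hex).1, ?_⟩, (Nat.find_spec hex).2⟩
  intro u hu hum
  apply Nat.find_min hex (m := u)
  · have := S.mult_spec.2
    omega
  · refine ⟨hu, ?_⟩
    have := (Nat.find_spec hex).2
    rw [← hum] at this
    simpa [Nat.ModEq] using this

theorem apery_of_add (S : NumericalSemigroup) {a b : ℕ} (ha : a ∈ S.carrier)
    (hb : b ∈ S.carrier) (h : a + b ∈ S.apery) : a ∈ S.apery := by
  refine ⟨ha, fun u hu hum => h.2 (u + b) (S.add_mem hu hb) (by omega)⟩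

theorem zero_mem_apery (S : NumericalSemigroup) : 0 ∈ S.apery :=
  ⟨S.zero_mem, fun u _ h => by have := S.mult_spec.2; omega⟩

theorem mem_of_apery_le (S : NumericalSemigroup) {a x : ℕ} (ha : a ∈ S.apery)
    (h : a ≡ x [MOD S.mult]) (hle : a ≤ x) : x ∈ S.carrier := by
  obtain ⟨k, hk⟩ := (Nat.modEq_iff_dvd' hle).1 h
  have := S.add_mul_mem ha.1 S.mult_spec.1 k
  have e : x = a + k * S.mult := by rw [mul_comm]; omega
  rwa [e]

theorem apery_card (S : NumericalSemigroup) : S.apery_finite.toFinset.card = S.mult := by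
  rw [← Finset.card_range S.mult]
  apply Finset.card_bij (fun a _ => a % S.mult)
  · intro a _
    exact Finset.mem_range.2 (Nat.mod_lt _ S.mult_spec.2)
  · intro a ha b hb hab
    exact S.apery_inj (by simpa using ha) (by simpa using hb) hab
  · intro r hr
    obtain ⟨a, ha, h⟩ := S.apery_cover r
    refine ⟨a, by simpa using ha, ?_⟩
    rw [Finset.mem_range] at hr
    rw [h, Nat.mod_eq_of_lt hr]

/-- The largest Apéry element determines the Frobenius number. -/
theorem exists_top (S : NumericalSemigroup) :
    ∃ W ∈ S.apery, (∀ a ∈ S.apery, a ≤ W) ∧ S.frob = (W : ℤ) - S.mult := by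
  have hne : S.apery_finite.toFinset.Nonempty := ⟨0, by simpa using S.zero_mem_apery⟩
  obtain ⟨W, hW, hmax⟩ := S.apery_finite.toFinset.exists_max_image id hne
  simp only [Set.Finite.mem_toFinset, id] at hW hmax
  refine ⟨W, hW, hmax, ?_⟩
  have hm := S.mult_spec.2
  have hWm : S.mult ≤ W + 1 := by
    rw [← S.apery_card, ← Finset.card_range (W + 1)]
    apply Finset.card_le_card
    intro a ha
    have := hmax a (by simpa using ha)
    simp; omega
  have : IsGreatest {x : ℤ | ∀ s ∈ S.carrier, (s : ℤ) ≠ x} ((W : ℤ) - S.mult) := by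
    constructor
    · intro s hs h
      exact hW.2 s hs (by omega)
    · intro x hx
      by_contra hlt
      push Not at hlt
      obtain ⟨y, rfl⟩ : ∃ y : ℕ, x = y := ⟨x.toNat, by omega⟩
      obtain ⟨a, ha, hay⟩ := S.apery_cover y
      refine hx y (S.mem_of_apery_le ha hay ?_) rfl
      by_contra hya
      push Not at hya
      have h1 := hmax a ha
      obtain ⟨k, hk⟩ := (Nat.modEq_iff_dvd' hya.le).1 hay.symm
      obtain _ | k := k
      · simp at hk; omega
      · have : S.mult * (k + 1) = S.mult * k + S.mult := by ring
        omega
  exact this.csSup_eq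

/-- Counting the small elements class by class. -/
theorem sum_le_small (S : NumericalSemigroup) {W : ℕ} (hW : W ∈ S.apery)
    (hf : S.frob = (W : ℤ) - S.mult) :
    ∑ a ∈ S.apery_finite.toFinset, (W - a) / S.mult ≤ S.small := by
  classical
  have hm := S.mult_spec.2
  have hfin : {s : ℕ | s ∈ S.carrier ∧ (s : ℤ) < S.frob}.Finite := by
    apply (Set.finite_Iio W).subset
    intro s hs
    have := hs.2
    simp only [Set.mem_Iio]
    omega
  have hc : ∑ a ∈ S.apery_finite.toFinset, (W - a) / S.mult =
      (S.apery_finite.toFinset.sigma fun a => Finset.range ((W - a) / S.mult)).card := by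
    rw [Finset.card_sigma]; simp
  rw [hc, small, ← Nat.card_coe_set_eq, Nat.card_eq_card_finite_toFinset hfin]
  apply Finset.card_le_card_of_injOn (fun p => p.1 + p.2 * S.mult)
  · rintro ⟨a, k⟩ hp
    simp only [Finset.coe_sigma, Set.mem_sigma_iff, Finset.mem_coe, Set.Finite.mem_toFinset,
      Finset.mem_range] at hp
    obtain ⟨ha, hk⟩ := hp
    have h1 : (k + 1) * S.mult ≤ W - a := (Nat.le_div_iff_mul_le hm).1 hk
    have h2 : (k + 1) * S.mult = k * S.mult + S.mult := by ring
    have h3 := S.add_mul_mem ha.1 S.mult_spec.1 k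
    simp only [Set.Finite.coe_toFinset, Set.mem_ofPred_eq]
    refine ⟨h3, ?_⟩
    have h4 := hW.2 _ h3
    rw [hf]
    generalize k * S.mult = z at *
    push_cast
    omega
  · rintro ⟨a, k⟩ hp ⟨b, l⟩ hq h
    simp only [Finset.coe_sigma, Set.mem_sigma_iff, Finset.mem_coe, Set.Finite.mem_toFinset,
      Finset.mem_range] at hp hq h
    have hab : a = b := by
      apply S.apery_inj hp.1 hq.1
      have : (a + k * S.mult) % S.mult = (b + l * S.mult) % S.mult := by rw [h]
      simpa [Nat.ModEq] using this
    subst hab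
    have : k = l := by simpa [hm.ne'] using h
    subst this
    rfl

/-- Carry estimate. -/
theorem div_carry (m W a b : ℕ) (hm : 0 < m) (h : a + b ≤ W) :
    W / m ≤ (W - a) / m + (W - b) / m + 1 := by
  have h1 := Nat.div_add_mod W m
  have h3 := Nat.div_add_mod (W - a) m
  have h4 := Nat.div_add_mod (W - b) m
  have l3 := Nat.mod_lt (W - a) hm
  have l4 := Nat.mod_lt (W - b) hm
  by_contra hcon
  push Not at hcon
  have : m * ((W - a) / m + (W - b) / m + 2) ≤ m * (W / m) :=
    Nat.mul_le_mul_left m hcon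
  rw [mul_add, mul_add] at this
  omega

/-- The combinatorial core for large embedding dimension. -/
theorem core (m W : ℕ) (hm : 0 < m) (A D : Finset ℕ) (hA : ∀ a ∈ A, m ≤ a)
    (hD : ∀ x ∈ D, x ≤ W ∧ ∃ p ∈ A, ∃ q ∈ A, x = p + q) (T : ℕ)
    (hT : T = ∑ a ∈ A, (W - a) / m) :
    (1 ≤ D.card → 1 ≤ T ∧ W / m ≤ 2 * T + 1) ∧
    (2 ≤ D.card → W / m ≤ T + 1) ∧
    (3 ≤ D.card → W / m ≤ T ∨ (D.card ≤ 3 ∧ 2 ≤ T ∧ ¬ (m = 7 ∧ W = 27 ∧ T = 2))) := by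
  classical
  have pos : ∀ p ∈ A, ∀ q ∈ A, p + q ≤ W → 1 ≤ (W - p) / m := by
    intro p _ q hq h
    rw [Nat.le_div_iff_mul_le hm]
    have := hA q hq
    omega
  have one : ∀ p ∈ A, (W - p) / m ≤ T := by
    intro p hp
    rw [hT]
    exact Finset.single_le_sum (f := fun a => (W - a) / m) (fun _ _ => Nat.zero_le _) hp
  have two : ∀ p ∈ A, ∀ q ∈ A, p ≠ q → (W - p) / m + (W - q) / m ≤ T := by
    intro p hp q hq hpq
    rw [hT, ← Finset.sum_pair (f := fun a => (W - a) / m) hpq]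
    apply Finset.sum_le_sum_of_subset
    intro x; simp; rintro (rfl | rfl) <;> assumption
  have three : ∀ p ∈ A, ∀ q ∈ A, ∀ r ∈ A, p ≠ q → p ≠ r → q ≠ r →
      (W - p) / m + ((W - q) / m + (W - r) / m) ≤ T := by
    intro p hp q hq r hr hpq hpr hqr
    rw [hT, ← Finset.sum_pair (f := fun a => (W - a) / m) hqr,
      ← Finset.sum_insert (f := fun a => (W - a) / m) (by simp [hpq, hpr])]
    apply Finset.sum_le_sum_of_subset
    intro x; simp; rintro (rfl | rfl | rfl) <;> assumption
  refine ⟨?_, ?_, ?_⟩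
  · intro h
    obtain ⟨x, hx⟩ := Finset.card_pos.1 h
    obtain ⟨hxW, p, hp, q, hq, rfl⟩ := hD x hx
    have := div_carry m W p q hm hxW
    have := pos p hp q hq hxW
    have := one p hp
    have := one q hq
    omega
  · intro h
    obtain ⟨x, hx, y, hy, hxy⟩ := Finset.one_lt_card.1 h
    obtain ⟨hxW, p, hp, q, hq, rfl⟩ := hD x hx
    obtain ⟨hyW, p', hp', q', hq', rfl⟩ := hD y hy
    have h1 := div_carry m W p q hm hxW
    have h2 := div_carry m W p' q' hm hyW
    by_cases e1 : p = q
    · by_cases e2 : p' = q'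
      · subst e1 e2
        have := two p hp p' hp' (by omega)
        omega
      · have := two p' hp' q' hq' e2
        omega
    · have := two p hp q hq e1
      omega
  · intro h
    by_cases hex : ∃ p ∈ A, ∃ q ∈ A, p < q ∧ p + q ∈ D
    · obtain ⟨p, hp, q, hq, hpq, hx⟩ := hex
      have hxW := (hD _ hx).1
      have h1 := div_carry m W p q hm hxW
      by_cases hj : ∃ j ∈ A, j ≠ p ∧ j ≠ q ∧ 1 ≤ (W - j) / m
      · obtain ⟨j, hjA, hjp, hjq, hj1⟩ := hj
        have := three p hp q hq j hjA hpq.ne hjp.symm hjq.symm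
        left; omega
      · right
        have hall : ∀ a ∈ A, ∀ b ∈ A, a + b ≤ W → a = p ∨ a = q := by
          intro a ha b hb hab
          by_contra hcon
          push Not at hcon
          exact hj ⟨a, ha, hcon.1, hcon.2, pos a ha b hb hab⟩
        have hsub : D ⊆ {p + p, p + q, q + q} := by
          intro y hy
          obtain ⟨hyW, a, ha, b, hb, rfl⟩ := hD y hy
          have ha' := hall a ha b hb hyW
          have hb' := hall b hb a ha (by omega)
          rcases ha' with rfl | rfl <;> rcases hb' with rfl | rfl <;> simp [add_comm]
        have hqq : q + q ∈ D := by
          by_contra hn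
          have : D ⊆ {p + p, p + q} := by
            intro y hy
            have := hsub hy
            simp only [Finset.mem_insert, Finset.mem_singleton] at this ⊢
            rcases this with h | h | h
            · exact Or.inl h
            · exact Or.inr h
            · subst h; exact absurd hy hn
          have := Finset.card_le_card this
          have := Finset.card_le_two (a := p + p) (b := p + q)
          omega
        have hqW := (hD _ hqq).1
        have c1 := pos p hp q hq hxW
        have c2 := pos q hq q hq hqW
        have c3 := two p hp q hq hpq.ne
        have c4 := Finset.card_le_card hsub
        have c5 := Finset.card_le_three (a := p + p) (b := p + q) (c := q + q)
        refine ⟨by omega, by omega, ?_⟩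
        rintro ⟨rfl, rfl, hT2⟩
        omega
    · left
      push Not at hex
      have hdiag : ∀ x ∈ D, x ≤ W ∧ ∃ p ∈ A, x = p + p := by
        intro x hx
        obtain ⟨hxW, p, hp, q, hq, rfl⟩ := hD x hx
        refine ⟨hxW, p, hp, ?_⟩
        rcases lt_trichotomy p q with h | h | h
        · exact absurd hx (hex p hp q hq h)
        · rw [h]
        · exact absurd (by rwa [add_comm]) (hex q hq p hp h)
      obtain ⟨x, y, z, hx, hy, hz, hxy, hxz, hyz⟩ := Finset.two_lt_card_iff.1 h
      obtain ⟨hxW, p, hp, rfl⟩ := hdiag x hx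
      obtain ⟨hyW, q, hq, rfl⟩ := hdiag y hy
      obtain ⟨hzW, r, hr, rfl⟩ := hdiag z hz
      have := three p hp q hq r hr (by omega) (by omega) (by omega)
      have := div_carry m W p p hm hxW
      have := div_carry m W q q hm hyW
      have := div_carry m W r r hm hzW
      have := pos p hp p hp hxW
      have := pos q hq q hq hyW
      have := pos r hr r hr hzW
      omega

/-- The final arithmetic in the case of large embedding dimension. -/
theorem arith (m v W T : ℕ) (hm : 0 < m) (hm8 : m ≤ 8) (hv : 4 ≤ v)
    (h1 : m ≤ v ∨ 1 ≤ m - v)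
    (c1 : 1 ≤ m - v → 1 ≤ T ∧ W / m ≤ 2 * T + 1)
    (c2 : 2 ≤ m - v → W / m ≤ T + 1)
    (c3 : 3 ≤ m - v → W / m ≤ T ∨ (m - v ≤ 3 ∧ 2 ≤ T ∧ ¬ (m = 7 ∧ W = 27 ∧ T = 2))) :
    W + 1 ≤ (W / m + T) * v + m := by
  by_cases h : m ≤ v
  · have a1 := Nat.div_add_mod W m
    have a2 := Nat.mod_lt W hm
    have a3 : m * (W / m) ≤ (W / m + T) * v := by
      rw [mul_comm]
      exact Nat.mul_le_mul (by omega) h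
    omega
  · push Not at h
    interval_cases m <;> first | omega | (interval_cases v <;> omega)

/-- An element of the span which is neither zero nor a generator decomposes. -/
theorem closure_decomp (G : Set ℕ) {x : ℕ} (hx : x ∈ AddSubmonoid.closure G) :
    x = 0 ∨ x ∈ G ∨ ∃ p ∈ AddSubmonoid.closure G, ∃ q ∈ AddSubmonoid.closure G,
      p ≠ 0 ∧ q ≠ 0 ∧ x = p + q := by
  induction hx using AddSubmonoid.closure_induction with
  | mem x hx => exact Or.inr (Or.inl hx)
  | zero => exact Or.inl rfl
  | add x y hx hy ihx ihy =>
    by_cases h1 : x = 0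
    · subst h1; simpa using ihy
    by_cases h2 : y = 0
    · subst h2; simpa using ihx
    exact Or.inr (Or.inr ⟨x, hx, y, hy, h1, h2, rfl⟩)

theorem mult_mem_gen (S : NumericalSemigroup) (G : Finset ℕ)
    (hG : S.carrier = (AddSubmonoid.closure (G : Set ℕ) : Set ℕ)) : S.mult ∈ G := by
  have hm := S.mult_spec
  have h := hm.1
  rw [hG] at h
  rcases closure_decomp _ h with h | h | ⟨p, hp, q, hq, hp0, hq0, h⟩
  · omega
  · exact h
  · have := S.mult_le (s := p) (by rw [hG]; exact hp) hp0
    omega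

theorem wilf_large (S : NumericalSemigroup) (h8 : S.mult ≤ 8) (G : Finset ℕ)
    (hG : S.carrier = (AddSubmonoid.closure (G : Set ℕ) : Set ℕ)) (h4 : 4 ≤ G.card) :
    S.frob + 1 ≤ (S.small : ℤ) * (G.card : ℤ) := by
  classical
  obtain ⟨W, hW, hmax, hf⟩ := S.exists_top
  have hm := S.mult_spec.2
  have hsum := S.sum_le_small hW hf
  set A := S.apery_finite.toFinset.erase 0 with hAdef
  have h0 : 0 ∈ S.apery_finite.toFinset := by simpa using S.zero_mem_apery
  rw [← Finset.add_sum_erase _ _ h0, ← hAdef] at hsum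
  have hmemA : ∀ a, a ∈ A ↔ a ≠ 0 ∧ a ∈ S.apery := by intro a; simp [hAdef]
  have hcard : S.mult - G.card ≤ (A \ G).card := by
    have e1 : A.card = S.mult - 1 := by
      rw [hAdef, Finset.card_erase_of_mem h0, S.apery_card]
    have e2 : A \ G = A \ (G.erase S.mult) := by
      ext a
      simp only [Finset.mem_sdiff, Finset.mem_erase]
      constructor
      · rintro ⟨h1, h2⟩; exact ⟨h1, fun h => h2 h.2⟩
      · rintro ⟨h1, h2⟩
        refine ⟨h1, fun h => h2 ⟨?_, h⟩⟩
        rintro rfl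
        exact ((hmemA _).1 h1).2.2 0 S.zero_mem (by simp)
    have e3 := Finset.card_erase_of_mem (S.mult_mem_gen G hG)
    have e4 := Finset.le_card_sdiff (G.erase S.mult) A
    rw [e2]
    omega
  obtain ⟨c1, c2, c3⟩ := core S.mult W hm A (A \ G)
    (fun a ha => S.mult_le ((hmemA a).1 ha).2.1 ((hmemA a).1 ha).1)
    (by
      intro x hx
      rw [Finset.mem_sdiff, hmemA] at hx
      obtain ⟨⟨hx0, hxA⟩, hxG⟩ := hx
      refine ⟨hmax x hxA, ?_⟩
      have hxS := hxA.1
      rw [hG] at hxS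
      rcases closure_decomp _ hxS with h | h | ⟨p, hp, q, hq, hp0, hq0, h⟩
      · exact absurd h hx0
      · exact absurd h hxG
      · have hp' : p ∈ S.carrier := by rw [hG]; exact hp
        have hq' : q ∈ S.carrier := by rw [hG]; exact hq
        refine ⟨p, (hmemA p).2 ⟨hp0, S.apery_of_add hp' hq' (h ▸ hxA)⟩,
          q, (hmemA q).2 ⟨hq0, S.apery_of_add hq' hp' ?_⟩, h⟩
        rw [add_comm]; exact h ▸ hxA) _ rfl
  have key := arith S.mult G.card W _ hm h8 h4 (by omega) (fun h => c1 (by omega))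
    (fun h => c2 (by omega)) (fun h => (c3 (by omega)).imp_right
      fun h' => ⟨by omega, h'.2⟩)
  simp only [Nat.sub_zero] at hsum
  have := Nat.mul_le_mul_right G.card hsum
  have h' : W + 1 ≤ S.small * G.card + S.mult := by omega
  rw [hf]
  have h'' : ((W + 1 : ℕ) : ℤ) ≤ ((S.small * G.card + S.mult : ℕ) : ℤ) := by exact_mod_cast h'
  push_cast at h''
  linarith

/-- A staircase with unique representatives modulo `m` is an L-shape. -/
theorem lshape (m g h N : ℕ) (B : ℕ → ℕ → Prop) (h00 : B 0 0)
    (down : ∀ p q p' q', B p q → p' ≤ p → q' ≤ q → B p' q')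
    (uniq : ∀ p q p' q', B p q → B p' q' → p * g + q * h ≡ p' * g + q' * h [MOD m] →
      p = p' ∧ q = q')
    (rep : ∀ p q, ∃ p' q', B p' q' ∧ p * g + q * h ≡ p' * g + q' * h [MOD m])
    (bdd : ∀ p q, B p q → p ≤ N ∧ q ≤ N) :
    ∃ x1 y1 x2 y2, B x1 y1 ∧ B x2 y2 ∧
      ∀ p q, B p q → (p ≤ x1 ∧ q ≤ y1) ∨ (p ≤ x2 ∧ q ≤ y2) := by
  classical
  have corner : ∀ x y, B x 0 → B 0 y → ¬ B x y →
      ∃ p q, p + 1 ≤ x ∧ q + 1 ≤ y ∧ B p y ∧ B (p + 1) q ∧ ¬ B (p + 1) (q + 1) ∧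
        (p + 1) * g + (q + 1) * h ≡ 0 [MOD m] := by
    intro x y hx hy hxy
    have ex1 : ∃ p, ¬ B p y := ⟨x, hxy⟩
    obtain ⟨p, hp⟩ : ∃ p, Nat.find ex1 = p + 1 :=
      Nat.exists_eq_succ_of_ne_zero fun h => Nat.find_spec ex1 (by rwa [h])
    have p1 : ¬ B (p + 1) y := hp ▸ Nat.find_spec ex1
    have p2 : B p y := not_not.1 (Nat.find_min ex1 (m := p) (by omega))
    have p3 : p + 1 ≤ x := hp ▸ Nat.find_min' ex1 hxy
    have ex2 : ∃ q, ¬ B (p + 1) q := ⟨y, p1⟩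
    obtain ⟨q, hq⟩ : ∃ q, Nat.find ex2 = q + 1 :=
      Nat.exists_eq_succ_of_ne_zero fun h =>
        Nat.find_spec ex2 (by rw [h]; exact down _ _ _ _ hx p3 le_rfl)
    have q1 : ¬ B (p + 1) (q + 1) := hq ▸ Nat.find_spec ex2
    have q2 : B (p + 1) q := not_not.1 (Nat.find_min ex2 (m := q) (by omega))
    have q3 : q + 1 ≤ y := hq ▸ Nat.find_min' ex2 p1
    refine ⟨p, q, p3, q3, p2, q2, q1, ?_⟩
    obtain ⟨p', q', hB, hmod⟩ := rep (p + 1) (q + 1)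
    rcases p' with _ | p'
    · rcases q' with _ | q'
      · simpa using hmod
      · exfalso
        have hm2 : (p + 1) * g + q * h ≡ 0 * g + q' * h [MOD m] := by
          apply Nat.ModEq.add_right_cancel' h
          convert hmod using 1 <;> ring
        have := uniq _ _ _ _ q2 (down _ _ _ _ hB le_rfl (by omega)) hm2
        omega
    · exfalso
      have hm2 : p * g + (q + 1) * h ≡ p' * g + q' * h [MOD m] := by
        apply Nat.ModEq.add_right_cancel' g
        convert hmod using 1 <;> ring
      have := uniq _ _ _ _ (down _ _ _ _ p2 le_rfl q3) (down _ _ _ _ hB (by omega) le_rfl) hm2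
      obtain ⟨rfl, rfl⟩ := this
      exact q1 hB
  obtain ⟨x, hx, hxmax⟩ : ∃ x, B x 0 ∧ ∀ p, B p 0 → p ≤ x := by
    refine ⟨Nat.findGreatest (fun p => B p 0) N, ?_, ?_⟩
    · exact Nat.findGreatest_spec (P := fun p => B p 0) (Nat.zero_le N) h00
    · intro p hp
      exact Nat.le_findGreatest (bdd _ _ hp).1 hp
  obtain ⟨y, hy, hymax⟩ : ∃ y, B 0 y ∧ ∀ q, B 0 q → q ≤ y := by
    refine ⟨Nat.findGreatest (fun q => B 0 q) N, ?_, ?_⟩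
    · exact Nat.findGreatest_spec (P := fun q => B 0 q) (Nat.zero_le N) h00
    · intro p hp
      exact Nat.le_findGreatest (bdd _ _ hp).2 hp
  have hbox : ∀ p q, B p q → p ≤ x ∧ q ≤ y := fun p q hpq =>
    ⟨hxmax p (down _ _ _ _ hpq le_rfl (Nat.zero_le _)),
      hymax q (down _ _ _ _ hpq (Nat.zero_le _) le_rfl)⟩
  by_cases hxy : B x y
  · exact ⟨x, y, x, y, hxy, hxy, fun p q hpq => Or.inl (hbox p q hpq)⟩
  obtain ⟨p, q, p3, q3, p2, q2, q1, hmod⟩ := corner x y hx hy hxy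
  have hxq : B x q := by
    by_contra hn
    obtain ⟨a, b, a3, b3, a2, b2, b1, hmod'⟩ :=
      corner x q hx (down _ _ _ _ hy le_rfl (by omega)) hn
    have hpa : p < a := by
      by_contra hle
      exact b1 (down _ _ _ _ q2 (by omega) (by omega))
    obtain ⟨s, rfl⟩ := Nat.exists_eq_add_of_lt hpa
    obtain ⟨t, rfl⟩ := Nat.exists_eq_add_of_le b3
    have : (s + 1) * g + 0 * h ≡ 0 * g + (t + 1) * h [MOD m] := by
      apply Nat.ModEq.add_right_cancel' ((p + 1) * g + (b + 1) * h)
      convert hmod'.trans hmod.symm using 1 <;> ring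
    have := uniq _ _ _ _ (down _ _ _ _ hx (by omega) le_rfl)
      (down _ _ _ _ hy le_rfl (by omega)) this
    omega
  refine ⟨p, y, x, q, p2, hxq, fun a b hab => ?_⟩
  have := hbox a b hab
  by_cases h1 : a ≤ p
  · exact Or.inl ⟨h1, this.2⟩
  · refine Or.inr ⟨this.1, ?_⟩
    by_contra h2
    exact q1 (down _ _ _ _ hab (by omega) (by omega))

/-- Two maximal Apéry elements suffice when there are at most three generators. -/
theorem two_max (S : NumericalSemigroup) (g h : ℕ) (hg : g ∈ S.carrier) (hh : h ∈ S.carrier)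
    (hg0 : 0 < g) (hh0 : 0 < h)
    (hS : ∀ s ∈ S.carrier, ∃ k p q, s = k * S.mult + p * g + q * h) :
    ∃ M1 ∈ S.apery, ∃ M2 ∈ S.apery, ∀ a ∈ S.apery,
      (∃ u ∈ S.carrier, a + u = M1) ∨ (∃ u ∈ S.carrier, a + u = M2) := by
  classical
  obtain ⟨W, hW, hmax, -⟩ := S.exists_top
  have hphi : ∀ p q, p * g + q * h ∈ S.carrier := by
    intro p q
    have := S.add_mul_mem (S.add_mul_mem S.zero_mem hg p) hh q
    simpa using this
  have hrep : ∀ a ∈ S.apery, ∃ p, ∃ q, a = p * g + q * h := by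
    intro a ha
    obtain ⟨k, p, q, hk⟩ := hS a ha.1
    rcases k with _ | k
    · exact ⟨p, q, by omega⟩
    · exfalso
      apply ha.2 (p * g + q * h + k * S.mult) (S.add_mul_mem (hphi p q) S.mult_spec.1 k)
      rw [hk]; ring
  let B : ℕ → ℕ → Prop := fun p q => p * g + q * h ∈ S.apery ∧
    ∀ p' q', p' * g + q' * h = p * g + q * h → p ≤ p'
  have hBrep : ∀ a ∈ S.apery, ∃ p q, B p q ∧ a = p * g + q * h := by
    intro a ha
    have hex := hrep a ha
    obtain ⟨q, hq⟩ := Nat.find_spec hex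
    refine ⟨Nat.find hex, q, ⟨hq ▸ ha, ?_⟩, hq⟩
    intro p' q' hpq
    exact Nat.find_min' hex ⟨q', by rw [hpq, ← hq]⟩
  have hsplit : ∀ p q p' q', p' ≤ p → q' ≤ q →
      p * g + q * h = (p' * g + q' * h) + ((p - p') * g + (q - q') * h) := by
    intro p q p' q' h1 h2
    obtain ⟨s, rfl⟩ := Nat.exists_eq_add_of_le h1
    obtain ⟨t, rfl⟩ := Nat.exists_eq_add_of_le h2
    simp only [Nat.add_sub_cancel_left]
    ring
  obtain ⟨x1, y1, x2, y2, hB1, hB2, hall⟩ := lshape S.mult g h W B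
    ⟨by simpa using S.zero_mem_apery, fun _ _ _ => Nat.zero_le _⟩
    (by
      rintro p q p' q' ⟨hpq, hmin⟩ h1 h2
      have e := hsplit p q p' q' h1 h2
      refine ⟨S.apery_of_add (hphi p' q') (hphi (p - p') (q - q')) (e ▸ hpq), ?_⟩
      intro a b hab
      have := hmin (a + (p - p')) (b + (q - q')) (by rw [e, ← hab]; ring)
      omega)
    (by
      rintro p q p' q' ⟨h1, h2⟩ ⟨h3, h4⟩ hmod
      have e := S.apery_inj h1 h3 hmod
      have l1 := h2 _ _ e.symm
      have l2 := h4 _ _ e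
      have : p = p' := by omega
      subst this
      refine ⟨rfl, ?_⟩
      have := Nat.add_left_cancel e
      exact Nat.eq_of_mul_eq_mul_right hh0 this)
    (by
      intro p q
      obtain ⟨a, ha, hmod⟩ := S.apery_cover (p * g + q * h)
      obtain ⟨p', q', hB, rfl⟩ := hBrep a ha
      exact ⟨p', q', hB, hmod.symm⟩)
    (by
      rintro p q ⟨h1, -⟩
      have := hmax _ h1
      have := Nat.le_mul_of_pos_right p hg0
      have := Nat.le_mul_of_pos_right q hh0
      omega)
  refine ⟨_, hB1.1, _, hB2.1, ?_⟩
  intro a ha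
  obtain ⟨p, q, hB, rfl⟩ := hBrep a ha
  rcases hall p q hB with ⟨h1, h2⟩ | ⟨h1, h2⟩
  · exact Or.inl ⟨_, hphi _ _, (hsplit _ _ _ _ h1 h2).symm⟩
  · exact Or.inr ⟨_, hphi _ _, (hsplit _ _ _ _ h1 h2).symm⟩

/-- If a set `P` of Apéry elements dominates the Apéry set, then `f + 1 ≤ n (|P| + 1)`. -/
theorem wilf_type (S : NumericalSemigroup) (P : Finset ℕ) (hP : ∀ M ∈ P, M ∈ S.apery)
    (hM : ∀ a ∈ S.apery, ∃ M ∈ P, ∃ u ∈ S.carrier, a + u = M) :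
    S.frob + 1 ≤ (S.small : ℤ) * ((P.card : ℤ) + 1) := by
  classical
  obtain ⟨W, hW, hmax, hf⟩ := S.exists_top
  have hfin : {s : ℕ | s ∈ S.carrier ∧ (s : ℤ) < S.frob}.Finite := by
    apply (Set.finite_Iio W).subset
    intro s hs
    have := hs.2
    simp only [Set.mem_Iio]
    omega
  by_cases hWm : W < S.mult
  · have : (0 : ℤ) ≤ (S.small : ℤ) * ((P.card : ℤ) + 1) := by positivity
    omega
  push Not at hWm
  have hsm : S.small = hfin.toFinset.card := by
    rw [small, ← Nat.card_coe_set_eq, Nat.card_eq_card_finite_toFinset hfin]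
  set F := hfin.toFinset with hF
  have hmemF : ∀ s, s ∈ S.carrier → s + S.mult ≤ W → s ∈ F := by
    intro s hs hle
    have := hW.2 s hs
    simp only [hF, Set.Finite.mem_toFinset, Set.mem_ofPred_eq]
    exact ⟨hs, by omega⟩
  have hcov : Finset.range (W - S.mult + 1) ⊆
      F ∪ P.biUnion (fun M => F.image (fun s => M - S.mult - s)) := by
    intro x hx
    rw [Finset.mem_range] at hx
    by_cases hxS : x ∈ S.carrier
    · exact Finset.mem_union_left _ (hmemF x hxS (by omega))
    apply Finset.mem_union_right
    obtain ⟨a, ha, hmod⟩ := S.apery_cover x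
    have hlt : x < a := by
      by_contra hle
      exact hxS (S.mem_of_apery_le ha hmod (by omega))
    obtain ⟨k, hk⟩ := (Nat.modEq_iff_dvd' hlt.le).1 hmod.symm
    obtain _ | k := k
    · simp at hk; omega
    have e : S.mult * (k + 1) = k * S.mult + S.mult := by ring
    obtain ⟨M, hMP, u, hu, hau⟩ := hM a ha
    have h1 := hmax M (hP M hMP)
    rw [Finset.mem_biUnion]
    refine ⟨M, hMP, ?_⟩
    rw [Finset.mem_image]
    refine ⟨u + k * S.mult, hmemF _ (S.add_mul_mem hu S.mult_spec.1 k) ?_, ?_⟩ <;> omega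
  have k1 := Finset.card_le_card hcov
  rw [Finset.card_range] at k1
  have k2 := Finset.card_union_le F (P.biUnion (fun M => F.image (fun s => M - S.mult - s)))
  have k3 := Finset.card_biUnion_le_card_mul P (fun M => F.image (fun s => M - S.mult - s))
    F.card (fun M _ => Finset.card_image_le)
  have k4 : W - S.mult + 1 ≤ F.card * (P.card + 1) := by
    have : F.card * (P.card + 1) = F.card + P.card * F.card := by ring
    omega
  rw [hf, hsm]
  have k5 : ((W - S.mult + 1 : ℕ) : ℤ) ≤ ((F.card * (P.card + 1) : ℕ) : ℤ) := by exact_mod_cast k4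
  push_cast [Nat.cast_sub hWm] at k5
  linarith

theorem wilf_two (S : NumericalSemigroup) (g : ℕ) (hg : g ∈ S.carrier)
    (hS : ∀ s ∈ S.carrier, ∃ k p, s = k * S.mult + p * g) :
    S.frob + 1 ≤ (S.small : ℤ) * 2 := by
  obtain ⟨W, hW, hmax, -⟩ := S.exists_top
  have hphi : ∀ p, p * g ∈ S.carrier := by
    intro p
    simpa using S.add_mul_mem S.zero_mem hg p
  have hrep : ∀ a ∈ S.apery, ∃ p, a = p * g := by
    intro a ha
    obtain ⟨k, p, hk⟩ := hS a ha.1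
    rcases k with _ | k
    · exact ⟨p, by omega⟩
    · exfalso
      apply ha.2 (p * g + k * S.mult) (S.add_mul_mem (hphi p) S.mult_spec.1 k)
      rw [hk]; ring
  have := S.wilf_type {W} (by simpa using hW) (by
    intro a ha
    refine ⟨W, by simp, W - a, ?_, by have := hmax a ha; omega⟩
    obtain ⟨p, rfl⟩ := hrep a ha
    obtain ⟨q, rfl⟩ := hrep W hW
    rw [← Nat.sub_mul]
    exact hphi _)
  simpa [one_add_one_eq_two] using this

theorem wilf_three (S : NumericalSemigroup) (g h : ℕ) (hg : g ∈ S.carrier) (hh : h ∈ S.carrier)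
    (hg0 : 0 < g) (hh0 : 0 < h)
    (hS : ∀ s ∈ S.carrier, ∃ k p q, s = k * S.mult + p * g + q * h) :
    S.frob + 1 ≤ (S.small : ℤ) * 3 := by
  classical
  obtain ⟨M1, hM1, M2, hM2, hM⟩ := S.two_max g h hg hh hg0 hh0 hS
  have := S.wilf_type {M1, M2} (by
    intro M hM
    simp only [Finset.mem_insert, Finset.mem_singleton] at hM
    rcases hM with rfl | rfl <;> assumption) (by
    intro a ha
    rcases hM a ha with h | h
    · exact ⟨M1, by simp, h⟩
    · exact ⟨M2, by simp, h⟩)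
  have hc := Finset.card_le_two (a := M1) (b := M2)
  have hs : (0 : ℤ) ≤ S.small := by positivity
  have hc' : ((({M1, M2} : Finset ℕ).card : ℤ)) ≤ 2 := by exact_mod_cast hc
  nlinarith

theorem wilf_gen (S : NumericalSemigroup) (h8 : S.mult ≤ 8) (G : Finset ℕ)
    (hG : S.carrier = (AddSubmonoid.closure (G : Set ℕ) : Set ℕ)) :
    S.frob + 1 ≤ (S.small : ℤ) * (G.card : ℤ) := by
  classical
  by_cases h4 : 4 ≤ G.card
  · exact S.wilf_large h8 G hG h4
  have hmG := S.mult_mem_gen G hG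
  have hGS : ∀ x ∈ G, x ∈ S.carrier := by
    intro x hx
    rw [hG]
    exact AddSubmonoid.subset_closure hx
  -- membership in terms of any list of generators containing the nonzero ones
  have hspan : ∀ g h : ℕ, (∀ x ∈ G, x = 0 ∨ x = S.mult ∨ x = g ∨ x = h) →
      ∀ s ∈ S.carrier, ∃ k p q, s = k * S.mult + p * g + q * h := by
    intro g h hx s hs
    rw [hG] at hs
    have hs' : s ∈ AddSubmonoid.closure (G : Set ℕ) := hs
    clear hs
    induction hs' using AddSubmonoid.closure_induction with
    | mem x hxG =>
      rcases hx x hxG with rfl | rfl | rfl | rfl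
      · exact ⟨0, 0, 0, by simp⟩
      · exact ⟨1, 0, 0, by simp⟩
      · exact ⟨0, 1, 0, by simp⟩
      · exact ⟨0, 0, 1, by simp⟩
    | zero => exact ⟨0, 0, 0, by simp⟩
    | add x y _ _ ihx ihy =>
      obtain ⟨k, p, q, rfl⟩ := ihx
      obtain ⟨k', p', q', rfl⟩ := ihy
      exact ⟨k + k', p + p', q + q', by ring⟩
  have hc : (G.erase S.mult).card = G.card - 1 := Finset.card_erase_of_mem hmG
  have hpos : 0 < G.card := Finset.card_pos.2 ⟨_, hmG⟩
  have hsplit : ∀ x ∈ G, x = S.mult ∨ x ∈ G.erase S.mult := by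
    intro x hx
    by_cases h : x = S.mult
    · exact Or.inl h
    · exact Or.inr (Finset.mem_erase.2 ⟨h, hx⟩)
  have hcases : G.card = 1 ∨ G.card = 2 ∨ G.card = 3 := by omega
  rcases hcases with h1 | h1 | h1
  · rw [h1] at hc
    have he := Finset.card_eq_zero.1 hc
    have hsp := hspan S.mult S.mult (by
      intro x hx
      rcases hsplit x hx with h | h
      · exact Or.inr (Or.inl h)
      · rw [he] at h; simp at h)
    obtain ⟨W, hW, hmax, hf⟩ := S.exists_top
    have hm := S.mult_spec
    have hW0 : W = 0 := by
      obtain ⟨k, p, q, hk⟩ := hsp W hW.1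
      have e : W = (k + p + q) * S.mult := by rw [hk]; ring
      apply S.apery_inj hW S.zero_mem_apery
      rw [e]
      simp [Nat.ModEq]
    have : (0 : ℤ) ≤ (S.small : ℤ) * (G.card : ℤ) := by positivity
    omega
  · rw [h1] at hc
    obtain ⟨g, he⟩ := Finset.card_eq_one.1 hc
    have hgG : g ∈ G := Finset.mem_of_mem_erase (a := S.mult) (by rw [he]; simp)
    have hsp := hspan g g (by
      intro x hx
      rcases hsplit x hx with h | h
      · exact Or.inr (Or.inl h)
      · rw [he] at h; simp at h; simp [h])
    have := S.wilf_two g (hGS g hgG) (by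
      intro s hs
      obtain ⟨k, p, q, hk⟩ := hsp s hs
      exact ⟨k, p + q, by rw [hk]; ring⟩)
    rw [h1]
    exact_mod_cast this
  · rw [h1] at hc
    obtain ⟨g, h, hgh, he⟩ := Finset.card_eq_two.1 hc
    have hgG : g ∈ G := Finset.mem_of_mem_erase (a := S.mult) (by rw [he]; simp)
    have hhG : h ∈ G := Finset.mem_of_mem_erase (a := S.mult) (by rw [he]; simp)
    have hcov : ∀ x ∈ G, x = S.mult ∨ x = g ∨ x = h := by
      intro x hx
      rcases hsplit x hx with h | h
      · exact Or.inl h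
      · rw [he] at h; simp at h; exact Or.inr h
    have hm := S.mult_spec
    have fix : ∀ z ∈ G, ∃ z' ∈ S.carrier, 0 < z' ∧ (z = 0 ∨ z = z') := by
      intro z hz
      by_cases hz0 : z = 0
      · exact ⟨S.mult, hm.1, hm.2, Or.inl hz0⟩
      · exact ⟨z, hGS z hz, Nat.pos_of_ne_zero hz0, Or.inr rfl⟩
    obtain ⟨g', hg', hg0, hgg⟩ := fix g hgG
    obtain ⟨h', hh', hh0, hhh⟩ := fix h hhG
    have := S.wilf_three g' h' hg' hh' hg0 hh0 (hspan g' h' (by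
      intro x hx
      have := hcov x hx
      omega))
    rw [h1]
    exact_mod_cast this

theorem exists_gen (S : NumericalSemigroup) : ∃ G : Finset ℕ,
    S.carrier = (AddSubmonoid.closure (G : Set ℕ) : Set ℕ) := by
  classical
  refine ⟨insert S.mult S.apery_finite.toFinset, ?_⟩
  apply Set.Subset.antisymm
  · intro x hx
    induction x using Nat.strong_induction_on with
    | _ x ih =>
      by_cases hxA : x ∈ S.apery
      · exact AddSubmonoid.subset_closure (by simp [hxA])
      · have : ∃ u ∈ S.carrier, u + S.mult = x := by
          by_contra hcon
          push Not at hcon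
          exact hxA ⟨hx, hcon⟩
        obtain ⟨u, hu, rfl⟩ := this
        have hm := S.mult_spec.2
        exact AddSubmonoid.add_mem _ (ih u (by omega) hu)
          (AddSubmonoid.subset_closure (by simp))
  · intro x hx
    have hx' : x ∈ AddSubmonoid.closure
      ((insert S.mult S.apery_finite.toFinset : Finset ℕ) : Set ℕ) := hx
    clear hx
    induction hx' using AddSubmonoid.closure_induction with
    | mem x hx =>
      simp only [Finset.coe_insert, Set.Finite.coe_toFinset, Set.mem_insert_iff] at hx
      rcases hx with rfl | hx
      · exact S.mult_spec.1
      · exact hx.1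
    | zero => exact S.zero_mem
    | add x y _ _ ihx ihy => exact S.add_mem ihx ihy

/-- If `m(S) ≤ 8` then `S` satisfies Wilf's conjecture. -/
theorem wilf_of_mult_le_eight (S : NumericalSemigroup)
    (h : S.mult ≤ 8) :
    S.frob + 1 ≤ (S.small : ℤ) * (S.embdim : ℤ) := by
  obtain ⟨G₀, hG₀⟩ := S.exists_gen
  have hne : {n : ℕ | ∃ G : Finset ℕ,
    S.carrier = (AddSubmonoid.closure (G : Set ℕ) : Set ℕ) ∧ G.card = n}.Nonempty :=
    ⟨G₀.card, G₀, hG₀, rfl⟩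
  obtain ⟨G, hG, hcard⟩ := Nat.sInf_mem hne
  have hcard' : G.card = S.embdim := hcard
  rw [← hcard']
  exact S.wilf_gen h G hG

end NumericalSemigroup
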